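/- Let N be a natural number and let S be a set of natural numbers such that for every prime p with p ≥ N, either p ∈ S or p' ∈ S, where p' denotes the smallest prime strictly greater than p. Then there exists a constant c > 0 such that for all sufficiently large k, the number of elements of S that are at most k is bounded below by c · k / log k. (This is the quantitative content of Corollary 1.2: the number of periods up to k of the periodic orbits produced by Theorem 1.1 grows at least like const · k / log k.) -/

import Mathlib

open Filter

/-- The smallest prime strictly greater than `p` (exists by the infinitude of primes). -/
noncomputable def nextPrime (p : ℕ) : ℕ := sInf {q : ℕ | Nat.Prime q ∧ p < q}

theorem nextPrime_spec (p : ℕ) : (nextPrime p).Prime ∧ p < nextPrime p :=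
  Nat.sInf_mem (s := {q : ℕ | q.Prime ∧ p < q}) <| by
    obtain ⟨q, hpq, hq⟩ := Nat.exists_infinite_primes (p + 1)
    exact ⟨q, hq, hpq⟩

theorem nextPrime_le {p q : ℕ} (hq : q.Prime) (hpq : p < q) : nextPrime p ≤ q :=
  Nat.sInf_le ⟨hq, hpq⟩

theorem nextPrime_lt_nextPrime {p q : ℕ} (hq : q.Prime) (hpq : p < q) :
    nextPrime p < nextPrime q :=
  (nextPrime_le hq hpq).trans_lt (nextPrime_spec q).2

theorem nextPrime_injOn : Set.InjOn nextPrime {p | p.Prime} := by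
  intro p hp q hq h
  rcases lt_trichotomy p q with hpq | hpq | hpq
  · exact absurd h (nextPrime_lt_nextPrime hq hpq).ne
  · exact hpq
  · exact absurd h (nextPrime_lt_nextPrime hp hpq).ne'

theorem nextPrime_eq_of_lt {p k : ℕ} (hpk : p ≤ k) (hk : k < nextPrime p) :
    nextPrime p = nextPrime k :=
  le_antisymm (nextPrime_le (nextPrime_spec k).1 (hpk.trans_lt (nextPrime_spec k).2))
    (nextPrime_le (nextPrime_spec p).1 hk)

theorem primeCounting_le_two_mul_ncard {N : ℕ} {S : Set ℕ}
    (hS : ∀ p : ℕ, Nat.Prime p → N ≤ p → p ∈ S ∨ nextPrime p ∈ S) (k : ℕ) :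
    Nat.primeCounting k ≤ 2 * (S ∩ Set.Iic k).ncard + N + 1 := by
  classical
  have hA : S ∩ Set.Iic k = ((Finset.Iic k).filter (· ∈ S) : Finset ℕ) := by
    ext x
    simp [and_comm]
  rw [hA, Set.ncard_coe_finset, ← Nat.primesLE_card_eq_primeCounting]
  set A := (Finset.Iic k).filter (· ∈ S)
  set B := (Nat.primesLE k).filter fun p ↦ N ≤ p ∧ p ∉ S
  have hB : B.card ≤ A.card + 1 := by
    refine (Finset.card_le_card_of_injOn (t := insert (nextPrime k) A) nextPrime ?_ ?_).trans
      (Finset.card_insert_le _ _)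
    · intro p hp
      simp only [B, Finset.coe_filter, Set.mem_ofPred_eq, Nat.mem_primesLE] at hp
      obtain ⟨⟨hpk, hp⟩, hN, hpS⟩ := hp
      rw [Finset.mem_coe, Finset.mem_insert]
      rcases lt_or_ge k (nextPrime p) with h | h
      · exact .inl (nextPrime_eq_of_lt hpk h)
      · exact .inr (by simpa [A, h] using (hS p hp hN).resolve_left hpS)
    · refine nextPrime_injOn.mono fun p hp ↦ ?_
      simp only [B, Finset.coe_filter, Set.mem_ofPred_eq, Nat.mem_primesLE] at hp
      exact hp.1.2
  have hsub : Nat.primesLE k ⊆ (A ∪ B) ∪ Finset.range N := by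
    intro p hp
    have hp' := Nat.mem_primesLE.1 hp
    simp only [A, B, Finset.mem_union, Finset.mem_filter, Finset.mem_Iic, Finset.mem_range, hp]
    grind
  have := Finset.card_le_card hsub
  have := Finset.card_union_le (A ∪ B) (Finset.range N)
  have := Finset.card_union_le A B
  rw [Finset.card_range] at *
  lia

/-- If `S ⊆ ℕ` is such that for every prime `p ≥ N` either `p ∈ S` or the next prime
`p' ∈ S`, then there is `c > 0` such that for all sufficiently large `k`, the number
of elements of `S` that are at most `k` is bounded below by `c·k/log k`. -/
theorem growth_of_periods {N : ℕ} {S : Set ℕ}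
    (hS : ∀ p : ℕ, Nat.Prime p → N ≤ p → p ∈ S ∨ nextPrime p ∈ S) :
    ∃ c : ℝ, 0 < c ∧ ∀ᶠ k : ℕ in atTop,
      c * (k : ℝ) / Real.log k ≤ ((S ∩ Set.Iic k).ncard : ℝ) := by
  have hlog2 : 0 < Real.log 2 := Real.log_pos one_lt_two
  refine ⟨Real.log 2 / 4, by positivity, ?_⟩
  have hε : 0 < Real.log 2 / (2 * (N + 3)) := by positivity
  filter_upwards [tendsto_natCast_atTop_atTop.eventually (Real.isLittleO_log_id_atTop.bound hε),
    eventually_ge_atTop 2] with k hk hk2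
  have hk2' : (2 : ℝ) ≤ k := mod_cast hk2
  have hlogk : 0 < Real.log k := Real.log_pos (by linarith)
  simp only [id, Real.norm_eq_abs, abs_of_pos hlogk, Nat.abs_cast] at hk
  rw [div_mul_eq_mul_div, le_div_iff₀ (by positivity)] at hk
  have hsucc : Real.log (k + 1) ≤ 2 * Real.log k := by
    rw [← Real.log_rpow (by linarith), Real.rpow_two]
    exact Real.log_le_log (by linarith) (by nlinarith)
  have hpi := Chebyshev.pi_ge k
  rw [div_le_iff₀ hlogk] at hpi
  have hcount : (Nat.primeCounting k : ℝ) ≤ 2 * (S ∩ Set.Iic k).ncard + N + 1 :=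
    mod_cast primeCounting_le_two_mul_ncard hS k
  have := mul_le_mul_of_nonneg_right hcount hlogk.le
  rw [div_le_iff₀ hlogk]
  linarith
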